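/- If X is distributed according to the invariant (uniform) measure on the Stiefel manifold {X ∈ ℝ^{N×r} : XᵀX = N I_r}, and v₁,…,v_r are fixed orthogonal vectors of norm √N, then there exist constants C(r), c(r) > 0 such that for every t > 0 and every 1 ≤ i,j ≤ r, P(|⟨v_i, x_j⟩/N| < t/√N) ≤ (4/√(2π)) t + C(r) exp(-c(r) t √N). -/

import Mathlib

open MeasureTheory Matrix

/-- Matrices over a measurable space carry the product measurable structure. -/
instance matrixMeasurableSpace {m n α : Type*} [MeasurableSpace α] :
    MeasurableSpace (Matrix m n α) :=
  (inferInstance : MeasurableSpace (m → n → α))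

open ProbabilityTheory

/-- Small-ball estimate for a centred real Gaussian. -/
lemma gaussianReal_zero_abs_lt_le {v : NNReal} (hv : v ≠ 0) (s : ℝ) :
    gaussianReal 0 v {y | |y| < s} ≤ ENNReal.ofReal (2 * s / Real.sqrt (2 * Real.pi * v)) := by
  have hset : {y : ℝ | |y| < s} = Set.Ioo (-s) s := by
    ext y; simp [abs_lt]
  have hpdf : ∀ y, gaussianPDF 0 v y ≤ ENNReal.ofReal (Real.sqrt (2 * Real.pi * v))⁻¹ := by
    intro y
    refine ENNReal.ofReal_le_ofReal ?_
    rw [gaussianPDFReal]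
    refine mul_le_of_le_one_right (by positivity) (Real.exp_le_one_iff.2 ?_)
    rw [neg_div]
    exact neg_nonpos.2 (by positivity)
  rw [hset, gaussianReal_apply 0 hv]
  calc ∫⁻ y in Set.Ioo (-s) s, gaussianPDF 0 v y
      ≤ ∫⁻ _ in Set.Ioo (-s) s, ENNReal.ofReal (Real.sqrt (2 * Real.pi * v))⁻¹ :=
        lintegral_mono fun y => hpdf y
    _ = ENNReal.ofReal (2 * s / Real.sqrt (2 * Real.pi * v)) := by
        rw [setLIntegral_const, Real.volume_Ioo, ← ENNReal.ofReal_mul (by positivity)]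
        congr 1
        ring

/-- A linear form of a standard Gaussian vector is a centred Gaussian. -/
lemma map_sum_mul_pi_gaussianReal {ι : Type*} [Fintype ι] (x : ι → ℝ) :
    (Measure.pi fun _ : ι => gaussianReal 0 1).map (fun g => ∑ k, g k * x k)
      = gaussianReal 0 (∑ k, x k ^ 2).toNNReal := by
  have hcomp : (fun g : ι → ℝ => ∑ k, g k * x k)
      = (innerSL ℝ (WithLp.toLp 2 x : EuclideanSpace ℝ ι)) ∘ WithLp.toLp 2 := by
    ext g
    simp [PiLp.inner_apply]
  rw [hcomp, ← Measure.map_map (by fun_prop) (by fun_prop), map_pi_eq_stdGaussian,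
    IsGaussian.map_eq_gaussianReal, integral_strongDual_stdGaussian, variance_dual_stdGaussian,
    innerSL_apply_norm, EuclideanSpace.real_norm_sq_eq]

lemma integral_exp_sq_div_four_gaussianReal :
    ∫ x, Real.exp (x ^ 2 / 4) ∂(gaussianReal 0 1) = Real.sqrt 2 := by
  rw [integral_gaussianReal_eq_integral_smul one_ne_zero]
  have h : ∀ x : ℝ, gaussianPDFReal 0 1 x • Real.exp (x ^ 2 / 4)
      = (Real.sqrt (2 * Real.pi))⁻¹ * Real.exp (-(1 / 4) * x ^ 2) := by
    intro x
    simp only [gaussianPDFReal, NNReal.coe_one, mul_one, sub_zero, smul_eq_mul]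
    rw [mul_assoc, ← Real.exp_add]
    congr 2
    ring
  simp_rw [h]
  rw [integral_const_mul, integral_gaussian, ← Real.sqrt_inv, ← Real.sqrt_mul (by positivity)]
  congr 1
  field_simp
  norm_num

/-- Upper tail of the squared norm of a standard Gaussian vector. -/
lemma pi_gaussianReal_sum_sq_ge_le {ι : Type*} [Fintype ι] :
    (Measure.pi fun _ : ι => gaussianReal 0 1) {g | 4 * (Fintype.card ι : ℝ) ≤ ∑ k, g k ^ 2}
      ≤ ENNReal.ofReal (Real.exp (-(1 / 2) * Fintype.card ι)) := by
  set γ : Measure (ι → ℝ) := Measure.pi fun _ : ι => gaussianReal 0 1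
  have hmgf : mgf (fun g : ι → ℝ => ∑ k, g k ^ 2) γ (1 / 4) = Real.sqrt 2 ^ Fintype.card ι := by
    have h : ∀ g : ι → ℝ, Real.exp (1 / 4 * ∑ k, g k ^ 2) = ∏ k, Real.exp (g k ^ 2 / 4) := by
      intro g
      rw [← Real.exp_sum, Finset.mul_sum]
      congr 1
      exact Finset.sum_congr rfl fun k _ => by ring
    simp_rw [mgf, h]
    rw [integral_fintype_prod_eq_prod (f := fun _ (y : ℝ) => Real.exp (y ^ 2 / 4))]
    simp [integral_exp_sq_div_four_gaussianReal]
  have hint : Integrable (fun g : ι → ℝ => Real.exp (1 / 4 * ∑ k, g k ^ 2)) γ := by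
    refine Integrable.of_integral_ne_zero ?_
    change mgf (fun g : ι → ℝ => ∑ k, g k ^ 2) γ (1 / 4) ≠ 0
    rw [hmgf]
    positivity
  have hsqrt : Real.sqrt 2 ≤ Real.exp (1 / 2) := by
    refine Real.sqrt_le_iff.2 ⟨by positivity, ?_⟩
    rw [← Real.exp_nat_mul]
    have := Real.add_one_le_exp (1 : ℝ)
    norm_num at this ⊢
    linarith
  rw [← ofReal_measureReal]
  refine ENNReal.ofReal_le_ofReal ?_
  calc γ.real {g | 4 * (Fintype.card ι : ℝ) ≤ ∑ k, g k ^ 2}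
      ≤ Real.exp (-(1 / 4) * (4 * (Fintype.card ι : ℝ)))
          * mgf (fun g : ι → ℝ => ∑ k, g k ^ 2) γ (1 / 4) :=
        measure_ge_le_exp_mul_mgf _ (by norm_num) hint
    _ ≤ Real.exp (-(1 / 4) * (4 * (Fintype.card ι : ℝ)))
          * Real.exp (1 / 2) ^ Fintype.card ι := by
        rw [hmgf]; gcongr
    _ = Real.exp (-(1 / 2) * Fintype.card ι) := by
        rw [← Real.exp_nat_mul, ← Real.exp_add]
        congr 1
        ring

/-- The Householder reflection exchanges two vectors of the same Euclidean norm. -/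
lemma exists_orthogonal_vecMul_eq {n : Type*} [Fintype n] [DecidableEq n] {a b : n → ℝ}
    (hab : a ⬝ᵥ a = b ⬝ᵥ b) : ∃ O : Matrix n n ℝ, Oᵀ * O = 1 ∧ a ᵥ* O = b := by
  by_cases hne : a = b
  · exact ⟨1, by simp, by simp [hne]⟩
  set w : n → ℝ := a - b with hw
  have hw0 : w ⬝ᵥ w ≠ 0 := fun h => hne (sub_eq_zero.1 (dotProduct_self_eq_zero.1 h))
  have haw : 2 * (a ⬝ᵥ w) = w ⬝ᵥ w := by
    simp only [hw, dotProduct_sub, sub_dotProduct, dotProduct_comm b a]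
    linarith
  refine ⟨1 - (2 / (w ⬝ᵥ w)) • vecMulVec w w, ?_, ?_⟩
  · simp only [transpose_sub, transpose_one, transpose_smul, transpose_vecMulVec]
    rw [sub_mul, one_mul, mul_sub, mul_one, Matrix.smul_mul, Matrix.mul_smul,
      vecMulVec_mul_vecMulVec, smul_smul]
    ext i j
    simp [vecMulVec_apply]
    field_simp
    ring
  · rw [vecMul_sub, vecMul_one, vecMul_smul, vecMul_vecMulVec]
    ext i
    have : a i - b i = w i := rfl
    simp
    field_simp
    linear_combination (-(w i)) * haw + (w ⬝ᵥ w) * this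

lemma measurable_matrix_apply {m n : Type*} (k : m) (j : n) :
    Measurable fun X : Matrix m n ℝ => X k j :=
  (measurable_pi_apply j).comp (measurable_pi_apply k)

lemma measurable_matrix_mul_left {l m n : Type*} [Fintype m] (O : Matrix l m ℝ) :
    Measurable fun X : Matrix m n ℝ => O * X := by
  refine measurable_pi_iff.2 fun i => measurable_pi_iff.2 fun j => ?_
  simp only [Matrix.mul_apply]
  exact Finset.measurable_sum _ fun k _ => (measurable_matrix_apply k j).const_mul _

section Invariant

variable {m n : Type*} [Fintype m] [DecidableEq m] {μ : Measure (Matrix m n ℝ)}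

/-- Under a measure invariant under orthogonal matrices, the law of a linear form of a column
depends only on the Euclidean norm of its coefficients. -/
lemma measure_abs_sum_lt_eq_of_invariant
    (hinv : ∀ O : Matrix m m ℝ, Oᵀ * O = 1 → Measure.map (fun X => O * X) μ = μ)
    {a b : m → ℝ} (hab : a ⬝ᵥ a = b ⬝ᵥ b) (j : n) (s : ℝ) :
    μ {X | |∑ k, a k * X k j| < s} = μ {X | |∑ k, b k * X k j| < s} := by
  obtain ⟨O, hO, haO⟩ := exists_orthogonal_vecMul_eq hab
  have hmeas : MeasurableSet {X : Matrix m n ℝ | |∑ k, a k * X k j| < s} :=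
    measurableSet_lt (Finset.measurable_sum _ fun k _ =>
      (measurable_matrix_apply k j).const_mul _).abs measurable_const
  conv_lhs => rw [← hinv O hO]
  rw [Measure.map_apply (measurable_matrix_mul_left O) hmeas]
  congr 1
  ext X
  have : ∑ k, a k * (O * X) k j = ∑ k, b k * X k j := by
    have h := congrFun (vecMul_vecMul a O X) j
    rw [haO] at h
    exact h.symm
  simp only [Set.preimage_ofPred_eq, Set.mem_ofPred_eq, this]

/-- Anti-concentration of a linear form of a column of norm `√(card m)`, by comparison with a
standard Gaussian vector. -/
lemma measure_abs_sum_lt_le_of_invariant [Nonempty m] [IsProbabilityMeasure μ]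
    (hinv : ∀ O : Matrix m m ℝ, Oᵀ * O = 1 → Measure.map (fun X => O * X) μ = μ)
    (j : n) (hnorm : ∀ᵐ X ∂μ, ∑ k, X k j ^ 2 = (Fintype.card m : ℝ))
    {a : m → ℝ} (ha : a ⬝ᵥ a = (Fintype.card m : ℝ)) {t : ℝ} (ht : 0 < t) :
    μ {X | |∑ k, a k * X k j| < t * Real.sqrt (Fintype.card m)}
      ≤ ENNReal.ofReal (4 / Real.sqrt (2 * Real.pi) * t)
        + ENNReal.ofReal (Real.exp (-(1 / 2) * Fintype.card m)) := by
  set d : ℝ := (Fintype.card m : ℝ) with hd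
  have hd0 : 0 < d := by simp [hd, Fintype.card_pos]
  set γ : Measure (m → ℝ) := Measure.pi fun _ : m => gaussianReal 0 1
  set p := μ {X | |∑ k, a k * X k j| < t * Real.sqrt d} with hp
  set B : Set (m → ℝ) := {g | 4 * d ≤ ∑ k, g k ^ 2}
  have hB : MeasurableSet B := measurableSet_le measurable_const (by fun_prop)
  have hcomp : ∀ g ∈ Bᶜ, p ≤ μ {X | |∑ k, g k * X k j| < 2 * t * Real.sqrt d} := by
    intro g hg
    have hg4 : ∑ k, g k ^ 2 < 4 * d := not_le.1 hg
    have hgg : g ⬝ᵥ g = ∑ k, g k ^ 2 := Finset.sum_congr rfl fun k _ => (sq (g k)).symm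
    rcases eq_or_ne g 0 with rfl | hg0
    · have : {X : Matrix m n ℝ | |∑ k, (0 : m → ℝ) k * X k j| < 2 * t * Real.sqrt d}
          = Set.univ := by
        ext X
        simp only [Pi.zero_apply, zero_mul, Finset.sum_const_zero, abs_zero, Set.mem_ofPred_eq,
          Set.mem_univ, iff_true]
        positivity
      rw [this, measure_univ]
      exact prob_le_one
    · have hgpos : 0 < g ⬝ᵥ g :=
        lt_of_le_of_ne (by rw [hgg]; positivity) fun h => hg0 (dotProduct_self_eq_zero.1 h.symm)
      set q := Real.sqrt (d / (g ⬝ᵥ g)) with hq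
      have hq2 : q ^ 2 = d / (g ⬝ᵥ g) := Real.sq_sqrt (by positivity)
      have hqhalf : 1 / 2 ≤ q := by
        refine Real.le_sqrt_of_sq_le ?_
        rw [le_div_iff₀ hgpos, hgg]
        linarith
      have hab : a ⬝ᵥ a = (q • g) ⬝ᵥ (q • g) := by
        rw [ha, smul_dotProduct, dotProduct_smul, smul_eq_mul, smul_eq_mul, ← mul_assoc, ← sq,
          hq2]
        field_simp
      rw [hp, measure_abs_sum_lt_eq_of_invariant hinv hab]
      refine measure_mono fun X hX => ?_
      simp only [Set.mem_ofPred_eq, Pi.smul_apply, smul_eq_mul, mul_assoc] at hX ⊢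
      rw [← Finset.mul_sum, abs_mul, abs_of_pos (by linarith)] at hX
      nlinarith [abs_nonneg (∑ k, g k * X k j)]
  have hγ : ∀ᵐ X ∂μ, γ {g | |∑ k, g k * X k j| < 2 * t * Real.sqrt d}
      ≤ ENNReal.ofReal (4 / Real.sqrt (2 * Real.pi) * t) := by
    filter_upwards [hnorm] with X hX
    have hlaw := map_sum_mul_pi_gaussianReal fun k => X k j
    rw [hX] at hlaw
    have hpre : γ {g | |∑ k, g k * X k j| < 2 * t * Real.sqrt d}
        = gaussianReal 0 d.toNNReal {y | |y| < 2 * t * Real.sqrt d} := by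
      rw [← hlaw, Measure.map_apply (by fun_prop) (measurableSet_lt (by fun_prop) (by fun_prop))]
      rfl
    rw [hpre]
    refine (gaussianReal_zero_abs_lt_le (by simpa using hd0) _).trans_eq ?_
    rw [Real.coe_toNNReal _ hd0.le, Real.sqrt_mul (by positivity)]
    congr 1
    have := Real.sqrt_pos.2 hd0
    field_simp
    ring
  have hmeas : MeasurableSet {z : (m → ℝ) × Matrix m n ℝ |
      |∑ k, z.1 k * z.2 k j| < 2 * t * Real.sqrt d} := by
    refine measurableSet_lt (Finset.measurable_sum _ fun k _ => ?_).abs measurable_const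
    exact ((measurable_pi_apply k).comp measurable_fst).mul
      ((measurable_matrix_apply k j).comp measurable_snd)
  have hfubini : ∫⁻ g, μ {X | |∑ k, g k * X k j| < 2 * t * Real.sqrt d} ∂γ
      = ∫⁻ X, γ {g | |∑ k, g k * X k j| < 2 * t * Real.sqrt d} ∂μ :=
    (Measure.prod_apply hmeas).symm.trans (Measure.prod_apply_symm hmeas)
  calc p = p * γ Bᶜ + p * γ B := by
        rw [← mul_add, add_comm, measure_add_measure_compl hB, measure_univ, mul_one]
    _ ≤ ∫⁻ g, μ {X | |∑ k, g k * X k j| < 2 * t * Real.sqrt d} ∂γ + γ B := by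
        refine add_le_add ?_ (mul_le_of_le_one_left' prob_le_one)
        rw [← setLIntegral_const]
        exact (setLIntegral_mono' hB.compl hcomp).trans (setLIntegral_le_lintegral _ _)
    _ ≤ _ := by
        refine add_le_add ?_ pi_gaussianReal_sum_sq_ge_le
        rw [hfubini]
        exact (lintegral_mono_ae hγ).trans_eq (by simp)

end Invariant

/-- **Anti-concentration of correlation entries under the invariant (uniform)
measure on the normalized Stiefel manifold** `{X : XᵀX = N I_r}`: each overlap
`⟨v_i, x_j⟩ / N` stays away from `0` at scale `N^{-1/2}` except with probability
at most `(4/√(2π)) t + C(r) exp(-c(r) t √N)`. -/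
theorem stiefel_invariant_measure_overlap_anticoncentration (r : ℕ) :
    ∃ C c : ℝ, 0 < C ∧ 0 < c ∧
      ∀ (N : ℕ) (μ : Measure (Matrix (Fin N) (Fin r) ℝ)),
        IsProbabilityMeasure μ →
        μ {X | Xᵀ * X = (N : ℝ) • (1 : Matrix (Fin r) (Fin r) ℝ)} = 1 →
        (∀ O : Matrix (Fin N) (Fin N) ℝ, Oᵀ * O = 1 →
          Measure.map (fun X => O * X) μ = μ) →
        ∀ v : Fin r → Fin N → ℝ,
          (∀ i j, (∑ k, v i k * v j k) = if i = j then (N : ℝ) else 0) →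
          ∀ (i j : Fin r) (t : ℝ), 0 < t →
            μ {X | |(∑ k, v i k * X k j) / N| < t / Real.sqrt N}
              ≤ ENNReal.ofReal (4 / Real.sqrt (2 * Real.pi) * t
                  + C * Real.exp (-c * t * Real.sqrt N)) := by
  refine ⟨1, 1 / 2, one_pos, by norm_num, ?_⟩
  intro N μ hμ hsupp hinv v hv i j t ht
  rcases Nat.eq_zero_or_pos N with rfl | hN
  · simp
  have : Nonempty (Fin N) := ⟨⟨0, hN⟩⟩
  have hN1 : (1 : ℝ) ≤ N := by exact_mod_cast hN
  have hsN : 0 < Real.sqrt N := Real.sqrt_pos.2 (by linarith)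
  have hsq : Real.sqrt N * Real.sqrt N = N := Real.mul_self_sqrt (by linarith)
  have hpi : Real.sqrt (2 * Real.pi) ≤ 4 :=
    Real.sqrt_le_iff.2 ⟨by norm_num, by nlinarith [Real.pi_le_four]⟩
  have hcoef : 1 ≤ 4 / Real.sqrt (2 * Real.pi) := by
    rw [le_div_iff₀ (by positivity)]
    linarith
  rcases le_or_gt 1 t with ht1 | ht1
  · refine prob_le_one.trans (ENNReal.one_le_ofReal.2 ?_)
    nlinarith [Real.exp_pos (-(1 / 2) * t * Real.sqrt N)]
  have hnorm : ∀ᵐ X ∂μ, ∑ k, X k j ^ 2 = (Fintype.card (Fin N) : ℝ) := by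
    have hae : ∀ᵐ X ∂μ, Xᵀ * X = (N : ℝ) • (1 : Matrix (Fin r) (Fin r) ℝ) := by
      have hclosed : MeasurableSet
          {X : Matrix (Fin N) (Fin r) ℝ | Xᵀ * X = (N : ℝ) • (1 : Matrix (Fin r) (Fin r) ℝ)} := by
        simp only [← Matrix.ext_iff, Set.ofPred_forall, Matrix.mul_apply, transpose_apply]
        refine MeasurableSet.iInter fun p => MeasurableSet.iInter fun q => ?_
        exact measurableSet_eq_fun (Finset.measurable_sum _ fun k _ =>
          (measurable_matrix_apply k p).mul (measurable_matrix_apply k q)) measurable_const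
      exact (mem_ae_iff_prob_eq_one hclosed).2 hsupp
    filter_upwards [hae] with X hX
    have h := congrFun (congrFun hX j) j
    simpa [Matrix.mul_apply, sq] using h
  have hset : {X : Matrix (Fin N) (Fin r) ℝ | |(∑ k, v i k * X k j) / N| < t / Real.sqrt N}
      = {X | |∑ k, v i k * X k j| < t * Real.sqrt (Fintype.card (Fin N))} := by
    ext X
    rw [Set.mem_ofPred_eq, Set.mem_ofPred_eq, Fintype.card_fin, abs_div, Nat.abs_cast,
      div_lt_iff₀ (by linarith)]
    have : t / Real.sqrt N * N = t * Real.sqrt N := by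
      rw [div_mul_eq_mul_div, div_eq_iff hsN.ne', mul_assoc, hsq]
    rw [this]
  rw [hset]
  refine (measure_abs_sum_lt_le_of_invariant hinv j hnorm
    (by simpa [dotProduct] using hv i i) ht).trans ?_
  rw [← ENNReal.ofReal_add (by positivity) (by positivity), one_mul, Fintype.card_fin]
  refine ENNReal.ofReal_le_ofReal (add_le_add_right (Real.exp_le_exp.2 ?_) _)
  have hsN1 : 1 ≤ Real.sqrt N := Real.one_le_sqrt.2 hN1
  nlinarith
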